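/- Exponential decay of the full resolvent kernel at non-small frequencies (Lemma 2.9): For every ν₀ > 0 there exist λ₁ > 0 and C > 0 such that for all κ ≥ ν₀: (i) 1 − 𝓛(−λ₁·κ + i·ω, κ) ≠ 0 for every ω ∈ ℝ; (ii) the function ω ↦ 𝓛(−λ₁·κ + i·ω,κ)/(1 − 𝓛(−λ₁·κ + i·ω,κ)) is (absolutely) integrable on ℝ; and (iii) for every t ≥ 0, |(1/(2π))·∫_ℝ exp((−λ₁·κ + i·ω)·t)·𝓛(−λ₁·κ + i·ω,κ)/(1 − 𝓛(−λ₁·κ + i·ω,κ)) dω| ≤ C·κ^{−1}·exp(−λ₁·κ·t). -/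

import Mathlib

open MeasureTheory Complex

/-- The Fourier transform of the Maxwellian along a fixed direction:
`F(s) = n₀ · exp(−β s²/2)`. -/
noncomputable def Fmax (n₀ β : ℝ) (s : ℝ) : ℝ := n₀ * Real.exp (-β * s ^ 2 / 2)

/-- The plasma dispersion function
`𝓛(z,κ) = −(w₀/κ²) ∫₀^∞ s F(s) exp(−(z/κ) s) ds` with `w₀ = ωp²/n₀`. -/
noncomputable def disp (n₀ β ωp : ℝ) (z : ℂ) (κ : ℝ) : ℂ :=
  -(((ωp ^ 2 / n₀ : ℝ) : ℂ) / (κ : ℂ) ^ 2) *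
    ∫ s in Set.Ioi (0 : ℝ),
      ((s : ℝ) : ℂ) * ((Fmax n₀ β s : ℝ) : ℂ) * Complex.exp (-(z / (κ : ℂ)) * ((s : ℝ) : ℂ))

noncomputable def GE (β : ℝ) (ζ : ℂ) (s : ℝ) : ℂ := cexp (-(β : ℂ) * (s : ℂ) ^ 2 / 2 - ζ * (s : ℂ))

noncomputable def GG (β : ℝ) (ζ : ℂ) : ℂ := ∫ s in Set.Ioi (0 : ℝ), (s : ℂ) * GE β ζ s

noncomputable def KK (β : ℝ) (k : ℕ) : ℝ :=
  ∫ s in Set.Ioi (0 : ℝ), s ^ k * Real.exp (-β * s ^ 2 / 2 + s)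

lemma GE_cont (β : ℝ) (ζ : ℂ) : Continuous (GE β ζ) := by
  unfold GE; fun_prop

lemma GE_norm (β : ℝ) (ζ : ℂ) (s : ℝ) :
    ‖GE β ζ s‖ = Real.exp (-β * s ^ 2 / 2 - ζ.re * s) := by
  unfold GE
  rw [Complex.norm_exp]
  congr 1
  have : (-(β : ℂ) * (s : ℂ) ^ 2 / 2) = ((-β * s ^ 2 / 2 : ℝ) : ℂ) := by push_cast; ring
  rw [this, Complex.sub_re, Complex.ofReal_re, Complex.mul_re]
  simp

lemma GE_norm_le (β : ℝ) (ζ : ℂ) (hζ : -1 ≤ ζ.re) (s : ℝ) (hs : 0 < s) :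
    ‖GE β ζ s‖ ≤ Real.exp (-β * s ^ 2 / 2 + s) := by
  rw [GE_norm]
  apply Real.exp_le_exp.2
  nlinarith

lemma KK_int (β : ℝ) (hβ : 0 < β) (k : ℕ) :
    IntegrableOn (fun s : ℝ => s ^ k * Real.exp (-β * s ^ 2 / 2 + s)) (Set.Ioi 0) := by
  have h := integrableOn_rpow_mul_exp_neg_mul_sq (b := β / 4) (by positivity) (s := (k : ℝ))
    (by have : (0 : ℝ) ≤ k := by positivity
        linarith)
  have h2 := h.const_mul (Real.exp (1 / β))
  refine Integrable.mono' h2 (by fun_prop) ?_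
  filter_upwards [ae_restrict_mem measurableSet_Ioi] with s hs
  have hs' : (0 : ℝ) < s := hs
  rw [Real.norm_of_nonneg (by positivity), Real.rpow_natCast]
  have : Real.exp (-β * s ^ 2 / 2 + s) ≤ Real.exp (1 / β) * Real.exp (-(β / 4) * s ^ 2) := by
    rw [← Real.exp_add]
    apply Real.exp_le_exp.2
    have : 0 ≤ (β * s - 2) ^ 2 / (4 * β) := by positivity
    have h3 : (β * s - 2) ^ 2 / (4 * β) = β * s ^ 2 / 4 - s + 1 / β := by
      field_simp; ring
    linarith
  calc s ^ k * Real.exp (-β * s ^ 2 / 2 + s)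
      ≤ s ^ k * (Real.exp (1 / β) * Real.exp (-(β / 4) * s ^ 2)) := by gcongr
    _ = _ := by ring

lemma KK_nonneg (β : ℝ) (k : ℕ) : 0 ≤ KK β k := by
  unfold KK
  apply setIntegral_nonneg measurableSet_Ioi
  intro s hs
  have hs' : (0 : ℝ) < s := hs
  positivity

lemma GE_int (β : ℝ) (hβ : 0 < β) (ζ : ℂ) (hζ : -1 ≤ ζ.re) (k : ℕ) :
    IntegrableOn (fun s : ℝ => (s : ℂ) ^ k * GE β ζ s) (Set.Ioi 0) := by
  have hc := GE_cont β ζ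
  refine Integrable.mono' (KK_int β hβ k) (by fun_prop) ?_
  filter_upwards [ae_restrict_mem measurableSet_Ioi] with s hs
  have hs' : (0 : ℝ) < s := hs
  rw [norm_mul, norm_pow, Complex.norm_of_nonneg hs'.le]
  gcongr
  exact GE_norm_le β ζ hζ s hs'

lemma GE_int_le (β : ℝ) (hβ : 0 < β) (ζ : ℂ) (hζ : -1 ≤ ζ.re) (k : ℕ) :
    ‖∫ s in Set.Ioi (0 : ℝ), (s : ℂ) ^ k * GE β ζ s‖ ≤ KK β k := by
  refine norm_integral_le_of_norm_le (KK_int β hβ k) ?_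
  filter_upwards [ae_restrict_mem measurableSet_Ioi] with s hs
  have hs' : (0 : ℝ) < s := hs
  rw [norm_mul, norm_pow, Complex.norm_of_nonneg hs'.le]
  gcongr
  exact GE_norm_le β ζ hζ s hs'

lemma GE_deriv (β : ℝ) (ζ : ℂ) (s : ℝ) :
    HasDerivAt (GE β ζ) ((-(β : ℂ) * s - ζ) * GE β ζ s) s := by
  have h1 : HasDerivAt (fun s : ℂ => cexp (-(β : ℂ) * s ^ 2 / 2 - ζ * s))
      (cexp (-(β : ℂ) * (s : ℂ) ^ 2 / 2 - ζ * s) * (-(β : ℂ) * (2 * s) / 2 - ζ)) (s : ℂ) := by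
    apply HasDerivAt.cexp
    apply HasDerivAt.sub
    · have := ((hasDerivAt_pow 2 (s : ℂ)).const_mul (-(β : ℂ))).div_const 2
      simpa using this
    · simpa using (hasDerivAt_id (s : ℂ)).const_mul ζ
  have h2 := h1.comp_ofReal
  unfold GE
  convert h2 using 1
  ring

/-- first integration by parts -/
lemma GG_ibp1 (β : ℝ) (hβ : 0 < β) (ζ : ℂ) (hζ : -1 ≤ ζ.re) :
    β * GG β ζ + ζ * (∫ s in Set.Ioi (0 : ℝ), GE β ζ s) = 1 := by
  have i0 : IntegrableOn (GE β ζ) (Set.Ioi 0) := by simpa using GE_int β hβ ζ hζ 0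
  have i1 : IntegrableOn (fun s : ℝ => (s : ℂ) * GE β ζ s) (Set.Ioi 0) := by
    simpa using GE_int β hβ ζ hζ 1
  have e : (fun s : ℝ => (-(β : ℂ) * s - ζ) * GE β ζ s) =
      fun s : ℝ => (-(β : ℂ)) * ((s : ℂ) * GE β ζ s) - ζ * GE β ζ s := by
    funext s; ring
  have i2 : IntegrableOn (fun s : ℝ => (-(β : ℂ) * s - ζ) * GE β ζ s) (Set.Ioi 0) := by
    rw [e]; exact (i1.const_mul _).sub (i0.const_mul _)
  have ht := tendsto_zero_of_hasDerivAt_of_integrableOn_Ioi (fun x _ => GE_deriv β ζ x) i2 i0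
  have := integral_Ioi_of_hasDerivAt_of_tendsto (GE_cont β ζ).continuousWithinAt
    (fun x _ => GE_deriv β ζ x) i2 ht
  rw [e, integral_sub (i1.const_mul _) (i0.const_mul _), integral_const_mul, integral_const_mul]
    at this
  have h0 : GE β ζ 0 = 1 := by simp [GE]
  rw [h0] at this
  unfold GG
  linear_combination -this

/-- second integration by parts -/
lemma GG_ibp2 (β : ℝ) (hβ : 0 < β) (ζ : ℂ) (hζ : -1 ≤ ζ.re) :
    ζ ^ 2 * GG β ζ = 1 + ((β : ℂ) ^ 2 * (∫ s in Set.Ioi (0 : ℝ), (s : ℂ) ^ 3 * GE β ζ s)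
      - 3 * β * (∫ s in Set.Ioi (0 : ℝ), (s : ℂ) ^ 1 * GE β ζ s)) := by
  have i0 := GE_int β hβ ζ hζ 0
  have i1 := GE_int β hβ ζ hζ 1
  have i2 := GE_int β hβ ζ hζ 2
  have i3 := GE_int β hβ ζ hζ 3
  let f : ℝ → ℂ := fun s => (ζ * s + (1 - β * (s : ℂ) ^ 2)) * GE β ζ s
  let f' : ℝ → ℂ := fun s => (ζ - β * (2 * s)) * GE β ζ s +
    (ζ * s + (1 - β * (s : ℂ) ^ 2)) * ((-(β : ℂ) * s - ζ) * GE β ζ s)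
  have hd : ∀ x ∈ Set.Ioi (0 : ℝ), HasDerivAt f (f' x) x := by
    intro x _
    refine HasDerivAt.mul ?_ (GE_deriv β ζ x)
    have h1 : HasDerivAt (fun s : ℂ => ζ * s + (1 - β * s ^ 2)) (ζ - β * (2 * x)) (x : ℂ) := by
      have a := (hasDerivAt_id (x : ℂ)).const_mul ζ
      have b := ((hasDerivAt_pow 2 (x : ℂ)).const_mul (β : ℂ)).const_sub 1
      refine (a.add b).congr_deriv ?_
      push_cast
      ring
    exact h1.comp_ofReal
  have ef : f = fun s : ℝ => ζ * ((s : ℂ) ^ 1 * GE β ζ s) + ((s : ℂ) ^ 0 * GE β ζ s) +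
      (-(β : ℂ)) * ((s : ℂ) ^ 2 * GE β ζ s) := by
    funext s; simp only [f]; ring
  have ef' : f' = fun s : ℝ => (-3 * (β : ℂ) - ζ ^ 2) * ((s : ℂ) ^ 1 * GE β ζ s) +
      (β : ℂ) ^ 2 * ((s : ℂ) ^ 3 * GE β ζ s) := by
    funext s; simp only [f']; ring
  have hi : IntegrableOn f (Set.Ioi 0) := by
    rw [ef]; exact ((i1.const_mul _).add i0).add (i2.const_mul _)
  have hi' : IntegrableOn f' (Set.Ioi 0) := by
    rw [ef']; exact (i1.const_mul _).add (i3.const_mul _)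
  have ht := tendsto_zero_of_hasDerivAt_of_integrableOn_Ioi hd hi' hi
  have hc : Continuous f := by
    have := GE_cont β ζ
    simp only [f]; fun_prop
  have := integral_Ioi_of_hasDerivAt_of_tendsto hc.continuousWithinAt hd hi' ht
  have h0 : f 0 = 1 := by simp [f, GE]
  rw [h0, ef', integral_add (i1.const_mul _) (i3.const_mul _), integral_const_mul,
    integral_const_mul] at this
  have hG : GG β ζ = ∫ s in Set.Ioi (0 : ℝ), (s : ℂ) ^ 1 * GE β ζ s := by simp [GG]
  rw [hG]
  linear_combination -this

lemma GG_decay (β : ℝ) (hβ : 0 < β) : ∃ K > (0 : ℝ), ∀ ζ : ℂ, -1 ≤ ζ.re →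
    ‖GG β ζ‖ * (1 + ζ.im ^ 2) ≤ K := by
  have k1 := KK_nonneg β 1
  have k3 := KK_nonneg β 3
  refine ⟨KK β 1 + (1 + (β ^ 2 * KK β 3 + 3 * β * KK β 1)), by positivity, ?_⟩
  intro ζ hζ
  have h1 := GE_int_le β hβ ζ hζ 1
  have h3 := GE_int_le β hβ ζ hζ 3
  have hG : GG β ζ = ∫ s in Set.Ioi (0 : ℝ), (s : ℂ) ^ 1 * GE β ζ s := by simp [GG]
  have hG1 : ‖GG β ζ‖ ≤ KK β 1 := by rw [hG]; exact h1
  have h4 : ‖ζ ^ 2 * GG β ζ‖ ≤ 1 + (β ^ 2 * KK β 3 + 3 * β * KK β 1) := by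
    rw [GG_ibp2 β hβ ζ hζ]
    refine (norm_add_le _ _).trans ?_
    rw [norm_one]
    gcongr
    refine (norm_sub_le _ _).trans ?_
    simp only [norm_mul, norm_pow, Complex.norm_of_nonneg hβ.le, Complex.norm_ofNat]
    gcongr
  rw [norm_mul, norm_pow] at h4
  have h5 : ζ.im ^ 2 ≤ ‖ζ‖ ^ 2 := by
    rw [← sq_abs]
    have := Complex.abs_im_le_norm ζ
    gcongr
  nlinarith [norm_nonneg (GG β ζ), mul_le_mul_of_nonneg_left h5 (norm_nonneg (GG β ζ))]

lemma exp_lip (s : ℝ) (hs : 0 < s) (a b : ℂ) (ha : -1 ≤ a.re) (hb : -1 ≤ b.re) :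
    ‖cexp (-a * s) - cexp (-b * s)‖ ≤ Real.exp s * (‖a - b‖ * s) := by
  have := Convex.norm_image_sub_le_of_norm_deriv_le (𝕜 := ℂ) (f := cexp) (s := {z : ℂ | z.re ≤ s})
    (C := Real.exp s) (x := -b * s) (y := -a * s)
    (fun x _ => Complex.differentiableAt_exp) (fun x hx => by
      rw [Complex.deriv_exp, Complex.norm_exp]
      exact Real.exp_le_exp.2 hx) (convex_halfSpace_re_le s)
    (by simp; nlinarith) (by simp; nlinarith)
  refine this.trans ?_
  have e : -a * (s : ℂ) - -b * s = -((a - b) * s) := by ring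
  rw [e, norm_neg, norm_mul, Complex.norm_of_nonneg hs.le]

lemma GG_lip (β : ℝ) (hβ : 0 < β) (a b : ℂ) (ha : -1 ≤ a.re) (hb : -1 ≤ b.re) :
    ‖GG β a - GG β b‖ ≤ KK β 2 * ‖a - b‖ := by
  have ia : IntegrableOn (fun s : ℝ => (s : ℂ) * GE β a s) (Set.Ioi 0) := by
    simpa using GE_int β hβ a ha 1
  have ib : IntegrableOn (fun s : ℝ => (s : ℂ) * GE β b s) (Set.Ioi 0) := by
    simpa using GE_int β hβ b hb 1
  unfold GG
  rw [← integral_sub ia ib]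
  unfold KK
  rw [← integral_mul_const]
  refine norm_integral_le_of_norm_le ((KK_int β hβ 2).mul_const _) ?_
  filter_upwards [ae_restrict_mem measurableSet_Ioi] with s hs
  have hs' : (0 : ℝ) < s := hs
  have hE : ∀ ζ : ℂ, GE β ζ s = ((Real.exp (-β * s ^ 2 / 2) : ℝ) : ℂ) * cexp (-ζ * s) := by
    intro ζ
    unfold GE
    rw [Complex.ofReal_exp, ← Complex.exp_add]
    congr 1
    push_cast
    ring
  have e : (s : ℂ) * GE β a s - s * GE β b s =
    ((s * Real.exp (-β * s ^ 2 / 2) : ℝ) : ℂ) * (cexp (-a * s) - cexp (-b * s)) := by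
    rw [hE, hE]; push_cast; ring
  rw [e, norm_mul, Complex.norm_of_nonneg (by positivity), Real.exp_add]
  calc _ ≤ s * Real.exp (-β * s ^ 2 / 2) * (Real.exp s * (‖a - b‖ * s)) := by
        gcongr; exact exp_lip s hs' a b ha hb
    _ = _ := by ring

lemma GG_line_cont (β : ℝ) (hβ : 0 < β) (x : ℝ) (hx : -1 ≤ x) :
    Continuous (fun y : ℝ => GG β ((x : ℂ) + I * y)) := by
  have : LipschitzWith (KK β 2).toNNReal (fun y : ℝ => GG β ((x : ℂ) + I * y)) := by
    apply LipschitzWith.of_dist_le_mul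
    intro y y'
    rw [dist_eq_norm, Real.coe_toNNReal _ (KK_nonneg β 2)]
    refine (GG_lip β hβ _ _ (by simpa using hx) (by simpa using hx)).trans ?_
    have e : (x : ℂ) + I * y - (x + I * y') = I * ((y - y' : ℝ) : ℂ) := by push_cast; ring
    rw [e, norm_mul, Complex.norm_I, one_mul, Complex.norm_real, dist_eq_norm]
  exact this.continuous

lemma J_re_ne (β : ℝ) (hβ : 0 < β) (y : ℝ) :
    (∫ s in Set.Ioi (0 : ℝ), GE β (I * y) s).re ≠ 0 := by
  have hfull := fourierIntegral_gaussian (b := ((β / 2 : ℝ) : ℂ))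
    (by rw [Complex.ofReal_re]; positivity) (-(y : ℂ))
  have hE : ∀ s : ℝ, cexp (I * -(y : ℂ) * s) * cexp (-((β / 2 : ℝ) : ℂ) * (s : ℂ) ^ 2) =
      GE β (I * y) s := by
    intro s
    unfold GE
    rw [← Complex.exp_add]
    congr 1
    push_cast
    ring
  simp only [hE] at hfull
  have hint : Integrable (GE β (I * y)) := by
    have := integrable_cexp_quadratic (b := ((β / 2 : ℝ) : ℂ))
      (by rw [Complex.ofReal_re]; positivity) (-(I * y)) 0
    refine this.congr (Filter.Eventually.of_forall fun s => ?_)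
    simp only [GE]
    congr 1
    push_cast
    ring
  have hsplit := intervalIntegral.integral_Iic_add_Ioi (b := 0) hint.integrableOn hint.integrableOn
  have hneg : (∫ s in Set.Iic (0 : ℝ), GE β (I * y) s) =
      (starRingEnd ℂ) (∫ s in Set.Ioi (0 : ℝ), GE β (I * y) s) := by
    rw [← integral_conj]
    have := integral_comp_neg_Ioi 0 (GE β (I * y))
    rw [neg_zero] at this
    rw [← this]
    congr 1
    funext s
    simp only [GE]
    rw [← Complex.exp_conj]
    congr 1
    have h2 : (starRingEnd ℂ) 2 = 2 := map_ofNat (starRingEnd ℂ) 2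
    simp [h2]
  intro h0
  rw [hneg, add_comm, Complex.add_conj, h0] at hsplit
  rw [← hsplit] at hfull
  have hne : ((Real.pi : ℂ) / ((β / 2 : ℝ) : ℂ)) ^ (1 / 2 : ℂ) *
      cexp (-(-(y : ℂ)) ^ 2 / (4 * ((β / 2 : ℝ) : ℂ))) ≠ 0 := by
    apply mul_ne_zero _ (Complex.exp_ne_zero _)
    rw [Ne, Complex.cpow_eq_zero_iff]
    rintro ⟨h, -⟩
    rw [← Complex.ofReal_div, Complex.ofReal_eq_zero] at h
    have : 0 < Real.pi / (β / 2) := by positivity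
    exact this.ne' h
  apply hne
  rw [← hfull]
  simp

/-- Penrose stability on the imaginary axis -/
lemma penrose (β : ℝ) (hβ : 0 < β) (θ : ℝ) (hθ : 0 ≤ θ) (y : ℝ) :
    1 + (θ : ℂ) * GG β (I * y) ≠ 0 := by
  intro h
  have hib := GG_ibp1 β hβ (I * y) (by simp)
  set J := ∫ s in Set.Ioi (0 : ℝ), GE β (I * y) s with hJ
  have hJ0 : J.re ≠ 0 := J_re_ne β hβ y
  set G := GG β (I * y) with hG
  have him := congrArg Complex.im hib
  have hre := congrArg Complex.re h
  have him2 := congrArg Complex.im h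
  have hre1 := congrArg Complex.re hib
  simp at him hre him2 hre1
  rcases him2 with h2 | h2
  · rw [h2] at hre; simp at hre
  · rw [h2] at him
    simp at him
    rcases him with h3 | h3
    · rw [h3] at hre1
      simp at hre1
      have : 0 < G.re := by
        by_contra hc
        push Not at hc
        nlinarith
      nlinarith [mul_nonneg hθ this.le]
    · exact hJ0 h3

lemma penrose_unif (β : ℝ) (hβ : 0 < β) (θ₀ : ℝ) (hθ₀ : 0 ≤ θ₀) :
    ∃ c > (0 : ℝ), ∀ θ : ℝ, 0 ≤ θ → θ ≤ θ₀ → ∀ y : ℝ, c ≤ ‖1 + (θ : ℂ) * GG β (I * y)‖ := by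
  obtain ⟨K, hK, hKb⟩ := GG_decay β hβ
  set Y := 2 * θ₀ * K + 1 with hY
  have hY1 : 1 ≤ Y := by rw [hY]; have : 0 ≤ 2 * θ₀ * K := by positivity
                         linarith
  have hcG : Continuous (fun y : ℝ => GG β (I * y)) := by
    simpa using GG_line_cont β hβ 0 (by norm_num)
  have hcont : Continuous (fun p : ℝ × ℝ => ‖1 + (p.1 : ℂ) * GG β (I * p.2)‖) := by
    have := hcG.comp (continuous_snd (X := ℝ) (Y := ℝ))
    have h1 : Continuous (fun p : ℝ × ℝ => (p.1 : ℂ)) := by fun_prop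
    exact (continuous_const.add (h1.mul this)).norm
  obtain ⟨p, hp, hmin⟩ := (isCompact_Icc.prod isCompact_Icc :
    IsCompact (Set.Icc 0 θ₀ ×ˢ Set.Icc (-Y) Y)).exists_isMinOn
    ⟨(0, 0), by constructor <;> constructor <;> simp <;> linarith⟩ hcont.continuousOn
  refine ⟨min (‖1 + (p.1 : ℂ) * GG β (I * p.2)‖) (1 / 2), ?_, ?_⟩
  · apply lt_min _ (by norm_num)
    exact norm_pos_iff.2 (penrose β hβ p.1 hp.1.1 p.2)
  intro θ h0 h1 y
  by_cases hy : |y| ≤ Y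
  · exact (min_le_left _ _).trans (hmin (a := (θ, y)) ⟨⟨h0, h1⟩, abs_le.1 hy⟩)
  · push Not at hy
    refine (min_le_right _ _).trans ?_
    have hb := hKb (I * y) (by simp)
    simp only [Complex.mul_im, Complex.I_re, Complex.I_im, Complex.ofReal_re, Complex.ofReal_im,
      zero_mul, one_mul, zero_add] at hb
    have hy2 : Y ≤ y ^ 2 := by rw [← sq_abs]; nlinarith
    have hsm : ‖(θ : ℂ) * GG β (I * y)‖ ≤ 1 / 2 := by
      rw [norm_mul, Complex.norm_of_nonneg h0]
      have hg := norm_nonneg (GG β (I * y))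
      have a1 : θ * ‖GG β (I * y)‖ ≤ θ₀ * ‖GG β (I * y)‖ := by gcongr
      refine a1.trans ?_
      have a2 : ‖GG β (I * y)‖ * (2 * θ₀ * K) ≤ K :=
        (mul_le_mul_of_nonneg_left (by linarith) hg).trans hb
      by_contra hc
      push Not at hc
      nlinarith
    have := norm_sub_norm_le (1 : ℂ) (-((θ : ℂ) * GG β (I * y)))
    rw [norm_neg, norm_one, sub_neg_eq_add] at this
    linarith

lemma disp_eq (n₀ β ωp : ℝ) (hn : 0 < n₀) (z : ℂ) (κ : ℝ) :
    disp n₀ β ωp z κ = -((ωp ^ 2 / κ ^ 2 : ℝ) : ℂ) * GG β (z / κ) := by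
  unfold disp GG
  have e : ∀ s : ℝ, (s : ℂ) * ((Fmax n₀ β s : ℝ) : ℂ) * cexp (-(z / (κ : ℂ)) * (s : ℂ)) =
      (n₀ : ℂ) * ((s : ℂ) * GE β (z / κ) s) := by
    intro s
    have h1 : GE β (z / κ) s = cexp (-(β : ℂ) * (s : ℂ) ^ 2 / 2) * cexp (-(z / (κ : ℂ)) * s) := by
      unfold GE
      rw [← Complex.exp_add]
      congr 1
      ring
    rw [h1]
    unfold Fmax
    push_cast
    ring
  simp only [e]
  rw [integral_const_mul]
  have : (n₀ : ℂ) ≠ 0 := by exact_mod_cast hn.ne'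
  push_cast
  field_simp

/-- **Exponential decay of the full resolvent kernel at non-small frequencies**
(Lemma 2.9). -/
theorem resolvent_kernel_decay_nonsmall_frequency
    (n₀ β ωp : ℝ) (hn : 0 < n₀) (hβ : 0 < β) (hω : 0 < ωp) :
    ∀ ν₀ : ℝ, 0 < ν₀ → ∃ lam₁ > (0:ℝ), ∃ C > (0:ℝ),
      ∀ κ : ℝ, ν₀ ≤ κ →
        (∀ ω : ℝ,
          1 - disp n₀ β ωp (((-lam₁ * κ : ℝ) : ℂ) + Complex.I * (ω : ℂ)) κ ≠ 0) ∧
        Integrable (fun ω : ℝ =>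
          disp n₀ β ωp (((-lam₁ * κ : ℝ) : ℂ) + Complex.I * (ω : ℂ)) κ /
            (1 - disp n₀ β ωp (((-lam₁ * κ : ℝ) : ℂ) + Complex.I * (ω : ℂ)) κ)) ∧
        ∀ t : ℝ, 0 ≤ t →
          ‖((2 * Real.pi : ℝ) : ℂ)⁻¹ * ∫ ω : ℝ,
              Complex.exp ((((-lam₁ * κ : ℝ) : ℂ) + Complex.I * (ω : ℂ)) * ((t : ℝ) : ℂ)) *
                (disp n₀ β ωp (((-lam₁ * κ : ℝ) : ℂ) + Complex.I * (ω : ℂ)) κ /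
                  (1 - disp n₀ β ωp (((-lam₁ * κ : ℝ) : ℂ) + Complex.I * (ω : ℂ)) κ))‖
            ≤ C * κ⁻¹ * Real.exp (-lam₁ * κ * t) := by
  intro ν₀ hν
  obtain ⟨K, hK, hKb⟩ := GG_decay β hβ
  set θ₀ := ωp ^ 2 / ν₀ ^ 2 with hθ₀
  have hθ₀p : 0 < θ₀ := by positivity
  obtain ⟨c, hc, hcb⟩ := penrose_unif β hβ θ₀ hθ₀p.le
  have hM := KK_nonneg β 2
  set M := KK β 2 with hMdef
  set lam := min 1 (c / (2 * (θ₀ * M + 1))) with hlam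
  have hlam0 : 0 < lam := by apply lt_min <;> positivity
  have hlam1 : lam ≤ 1 := min_le_left _ _
  have hlamM : θ₀ * (M * lam) ≤ c / 2 := by
    have h1 : lam ≤ c / (2 * (θ₀ * M + 1)) := min_le_right _ _
    rw [le_div_iff₀ (by positivity)] at h1
    nlinarith
  refine ⟨lam, hlam0, ωp ^ 2 * K / c, by positivity, ?_⟩
  intro κ hκ
  have hκ0 : 0 < κ := hν.trans_le hκ
  have hκc : (κ : ℂ) ≠ 0 := by exact_mod_cast hκ0.ne'
  set θ := ωp ^ 2 / κ ^ 2 with hθ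
  have hθ0 : 0 < θ := by positivity
  have hθle : θ ≤ θ₀ := by rw [hθ, hθ₀]; gcongr
  have hd : ∀ ω : ℝ, disp n₀ β ωp (((-lam * κ : ℝ) : ℂ) + Complex.I * (ω : ℂ)) κ =
      -(θ : ℂ) * GG β (((-lam : ℝ) : ℂ) + I * ((ω / κ : ℝ) : ℂ)) := by
    intro ω
    rw [disp_eq n₀ β ωp hn]
    congr 2
    push_cast
    field_simp
  simp only [hd]
  have hlow : ∀ y : ℝ, c / 2 ≤ ‖1 - -(θ : ℂ) * GG β (((-lam : ℝ) : ℂ) + I * (y : ℂ))‖ := by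
    intro y
    have h1 := hcb θ hθ0.le hθle y
    have h2 := GG_lip β hβ (((-lam : ℝ) : ℂ) + I * (y : ℂ)) (I * y) (by simpa using hlam1) (by simp)
    have e1 : ((-lam : ℝ) : ℂ) + I * (y : ℂ) - I * y = ((-lam : ℝ) : ℂ) := by ring
    rw [e1, Complex.norm_real, norm_neg, Real.norm_of_nonneg hlam0.le] at h2
    set A := GG β (((-lam : ℝ) : ℂ) + I * (y : ℂ))
    set B := GG β (I * (y : ℂ))
    have e2 : 1 + (θ : ℂ) * B = (1 - -(θ : ℂ) * A) - θ * (A - B) := by ring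
    rw [e2] at h1
    have h3 := norm_sub_le (1 - -(θ : ℂ) * A) (θ * (A - B))
    have h4 : ‖(θ : ℂ) * (A - B)‖ ≤ c / 2 := by
      rw [norm_mul, Complex.norm_of_nonneg hθ0.le]
      refine le_trans ?_ hlamM
      gcongr
    linarith
  have hne : ∀ y : ℝ, 1 - -(θ : ℂ) * GG β (((-lam : ℝ) : ℂ) + I * (y : ℂ)) ≠ 0 := by
    intro y h
    have := hlow y
    rw [h, norm_zero] at this
    linarith
  set q : ℝ → ℂ := fun y => -(θ : ℂ) * GG β (((-lam : ℝ) : ℂ) + I * (y : ℂ)) /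
    (1 - -(θ : ℂ) * GG β (((-lam : ℝ) : ℂ) + I * (y : ℂ))) with hq
  have hqc : Continuous q := by
    have := GG_line_cont β hβ (-lam) (by linarith)
    exact (continuous_const.mul this).div (continuous_const.sub (continuous_const.mul this)) hne
  have hqb : ∀ y, ‖q y‖ ≤ (2 * θ * K / c) * (1 + y ^ 2)⁻¹ := by
    intro y
    simp only [hq]
    rw [norm_div, norm_mul, norm_neg, Complex.norm_of_nonneg hθ0.le]
    have h1 := hKb (((-lam : ℝ) : ℂ) + I * (y : ℂ)) (by simpa using hlam1)
    simp only [Complex.add_im, Complex.mul_im, Complex.I_re, Complex.I_im, Complex.ofReal_re,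
      Complex.ofReal_im, zero_mul, one_mul, zero_add] at h1
    rw [← le_div_iff₀ (by positivity)] at h1
    calc _ ≤ θ * (K / (1 + y ^ 2)) / (c / 2) := by
          gcongr
          exact hlow y
      _ = _ := by field_simp
  have hbi : Integrable (fun ω : ℝ => (2 * θ * K / c) * (1 + (ω / κ) ^ 2)⁻¹) :=
    (integrable_inv_one_add_sq.comp_div hκ0.ne').const_mul _
  have hbv : ∫ ω : ℝ, (2 * θ * K / c) * (1 + (ω / κ) ^ 2)⁻¹ = (2 * θ * K / c) * (κ * Real.pi) := by
    rw [integral_const_mul, Measure.integral_comp_div (fun y : ℝ => (1 + y ^ 2)⁻¹) κ,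
      integral_univ_inv_one_add_sq, abs_of_pos hκ0, smul_eq_mul]
  refine ⟨fun ω => hne (ω / κ), ?_, ?_⟩
  · refine hbi.mono' ?_ (Filter.Eventually.of_forall fun ω => hqb (ω / κ))
    exact (hqc.comp (continuous_id.div_const κ)).aestronglyMeasurable
  · intro t ht
    have hI : ‖∫ ω : ℝ, cexp ((((-lam * κ : ℝ) : ℂ) + I * (ω : ℂ)) * ((t : ℝ) : ℂ)) * q (ω / κ)‖ ≤
        ∫ ω : ℝ, Real.exp (-lam * κ * t) * ((2 * θ * K / c) * (1 + (ω / κ) ^ 2)⁻¹) := by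
      refine norm_integral_le_of_norm_le (hbi.const_mul _)
        (Filter.Eventually.of_forall fun ω => ?_)
      rw [norm_mul, Complex.norm_exp]
      have e : ((((-lam * κ : ℝ) : ℂ) + I * (ω : ℂ)) * ((t : ℝ) : ℂ)).re = -lam * κ * t := by
        simp
      rw [e]
      gcongr
      exact hqb (ω / κ)
    rw [integral_const_mul, hbv] at hI
    rw [norm_mul, norm_inv, Complex.norm_of_nonneg (by positivity)]
    calc _ ≤ (2 * Real.pi)⁻¹ * (Real.exp (-lam * κ * t) * ((2 * θ * K / c) * (κ * Real.pi))) := by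
          gcongr
      _ = _ := by
          rw [hθ]
          field_simp
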